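/- Fix n distinct rational numbers α_1,…,α_n and 1 ≤ k ≤ n. For every d > n−k, the polynomial Σ_{a+b = d} (−1)^a e_a(x_1,…,x_n) · h_b(α_1,…,α_k) in ℚ[x_1,…,x_n] vanishes at every point of X_{n,k}. Consequently, e_d ∈ T(X_{n,k}) for all d > n−k. -/

import Mathlib

open scoped BigOperators

namespace PackedWords

/-- An ordered set partition of `[n] = {1, …, n}` with `k` blocks: a sequence
`B_1 | ⋯ | B_k` of nonempty pairwise disjoint subsets of `[n]` whose union is `[n]`. -/
structure OSP (n k : ℕ) where
  blocks : Fin k → Finset ℕ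
  subset_range : ∀ j, blocks j ⊆ Finset.Icc 1 n
  blocks_nonempty : ∀ j, (blocks j).Nonempty
  blocks_disjoint : ∀ j₁ j₂ : Fin k, j₁ ≠ j₂ → Disjoint (blocks j₁) (blocks j₂)
  cover : ∀ i ∈ Finset.Icc 1 n, ∃ j, i ∈ blocks j

/-- Common generalization of the coinversion code (`b = 0`) and the boosted
coinversion code (`b = 1`).  Position `p : Fin n` corresponds to the letter
`i = p + 1` of `[n]`.  If `i ∈ B_j` (blocks indexed `0, …, k-1`, so `j` here is
the paper's `j - 1`), then `c_i = #{ℓ > j : min B_ℓ > i}` if `i = min B_j`, and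
`c_i = #{ℓ > j : min B_ℓ > i} + (j - 1) + b` (in the paper's 1-indexing) otherwise. -/
noncomputable def codeAux {n k : ℕ} (b : ℕ) (σ : OSP n k) (p : Fin n) : ℕ :=
  if h : ∃ j, ((p : ℕ) + 1) ∈ σ.blocks j then
    (Finset.univ.filter fun ℓ : Fin k =>
        h.choose < ℓ ∧ ∀ x ∈ σ.blocks ℓ, (p : ℕ) + 1 < x).card
      + (if ∀ x ∈ σ.blocks h.choose, (p : ℕ) + 1 ≤ x then 0 else (h.choose : ℕ) + b)
  else 0

/-- The coinversion code of an ordered set partition. -/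
noncomputable def code {n k : ℕ} (σ : OSP n k) : Fin n → ℕ := codeAux 0 σ

/-- The boosted coinversion code of an ordered set partition. -/
noncomputable def bcode {n k : ℕ} (σ : OSP n k) : Fin n → ℕ := codeAux 1 σ

/-- The skip sequence of a finite set `S = {s_1 < s_2 < ⋯} ⊆ ℕ`:
`γ_i = i - j + 1` if `i = s_j ∈ S`, and `γ_i = 0` otherwise. -/
def skip (S : Finset ℕ) (i : ℕ) : ℕ :=
  if i ∈ S then i - (S.filter (· < i)).card else 0

/-- The reverse skip sequence `γ(S)* = (γ_n, …, γ_1)` of `S ⊆ [n]`, read at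
position `p : Fin n` (so position `p` carries `γ_{n - p}` in 1-indexed terms). -/
def revSkipAt (n : ℕ) (S : Finset ℕ) (p : Fin n) : ℕ := skip S (n - (p : ℕ))

/-- For `T ⊆ [n-1]` with skip sequence `γ = γ(T)`, the length-`n` sequence
`(γ_{n-1}, …, γ_i, d, γ_{i-1}, …, γ_1)` obtained from the reverse skip sequence of `T`
by inserting `d` in position `n - i + 1` (1-indexed), read at position `p : Fin n`. -/
def insSeq (n i d : ℕ) (T : Finset ℕ) (p : Fin n) : ℕ :=
  if (p : ℕ) + 1 ≤ n - i then skip T (n - ((p : ℕ) + 1))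
  else if (p : ℕ) + 1 = n - i + 1 then d
  else skip T (n - ((p : ℕ) + 1) + 1)

/-- `Packedk n k w`: `w` is a packed word of length `n` on the alphabet of positive
integers (whenever `i + 1` appears as a letter, so does `i`) in which each of the
letters `1, 2, …, k` appears. -/
def Packedk (n k : ℕ) (w : Fin n → ℕ) : Prop :=
  (∀ p, 1 ≤ w p) ∧ (∀ i, 1 ≤ i → (∃ p, w p = i + 1) → ∃ p, w p = i) ∧
    (∀ j, 1 ≤ j → j ≤ k → ∃ p, w p = j)

/-- The elementary symmetric polynomial of degree `a` in the variables `X j`, `j ∈ s`. -/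
noncomputable def esymmOn (n : ℕ) (s : Finset (Fin n)) (a : ℕ) : MvPolynomial (Fin n) ℚ :=
  ∑ t ∈ s.powersetCard a, ∏ j ∈ t, MvPolynomial.X j

/-- The complete homogeneous symmetric polynomial of degree `b` evaluated at
`α 1, α 2, …, α d`. -/
noncomputable def hval (b d : ℕ) (α : ℕ → ℚ) : ℚ :=
  ∑ m : Sym (Fin d) b, ((m : Multiset (Fin d)).map fun j => α ((j : ℕ) + 1)).prod

/-- The locus `X_{n,k} ⊆ ℚ^n` of points `(α_{w_1}, …, α_{w_n})` for `w ∈ W_{n,k}`. -/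
def packedPoints (n k : ℕ) (α : ℕ → ℚ) : Set (Fin n → ℚ) :=
  {x | ∃ w : Fin n → ℕ, Packedk n k w ∧ x = fun p => α (w p)}

/-- The ideal `J_n = ⟨x_i^d e_{n-r}^{(i)} : 1 ≤ i ≤ n, 1 ≤ r ≤ d⟩`. -/
noncomputable def Jn (n : ℕ) : Ideal (MvPolynomial (Fin n) ℚ) :=
  Ideal.span {g | ∃ (i : Fin n) (r d : ℕ), 1 ≤ r ∧ r ≤ d ∧
    g = MvPolynomial.X i ^ d * esymmOn n {i}ᶜ (n - r)}

/-- The ideal `J_{n,k} = J_n + ⟨e_n, e_{n-1}, …, e_{n-k+1}⟩`. -/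
noncomputable def Jnk (n k : ℕ) : Ideal (MvPolynomial (Fin n) ℚ) :=
  Jn n ⊔ Ideal.span {g | ∃ j : ℕ, n - k + 1 ≤ j ∧ j ≤ n ∧ g = esymmOn n Finset.univ j}

/-- The Haglund–Rhoades–Shimozono ideal
`I_{n,k} = ⟨x_1^k, …, x_n^k, e_n, e_{n-1}, …, e_{n-k+1}⟩`. -/
noncomputable def Ink (n k : ℕ) : Ideal (MvPolynomial (Fin n) ℚ) :=
  Ideal.span ({g | ∃ i : Fin n, g = MvPolynomial.X i ^ k} ∪
    {g | ∃ j : ℕ, n - k + 1 ≤ j ∧ j ≤ n ∧ g = esymmOn n Finset.univ j})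

/-- `T(X)`: the ideal generated by the top-degree homogeneous components `τ(f)` of
all nonzero polynomials `f` vanishing on `X`. -/
noncomputable def gradedIdeal (n : ℕ) (X : Set (Fin n → ℚ)) : Ideal (MvPolynomial (Fin n) ℚ) :=
  Ideal.span {g | ∃ f : MvPolynomial (Fin n) ℚ, f ≠ 0 ∧
    (∀ x ∈ X, MvPolynomial.eval x f = 0) ∧
    g = MvPolynomial.homogeneousComponent f.totalDegree f}

/-- The degree-`d` homogeneous component of the quotient `ℚ[x_1, …, x_n]/I`,
namely the image of the space of homogeneous polynomials of degree `d`. -/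
noncomputable def quotComp (n : ℕ) (I : Ideal (MvPolynomial (Fin n) ℚ)) (d : ℕ) :
    Submodule ℚ (MvPolynomial (Fin n) ℚ ⧸ I) :=
  Submodule.map (Ideal.Quotient.mkₐ ℚ I).toLinearMap
    (MvPolynomial.homogeneousSubmodule (Fin n) ℚ d)

/-- The degree-`(d - a)` homogeneous component of `ℚ[x_1, …, x_n]/I`, interpreted as
zero when `d - a < 0` (degree shift by `a`). -/
noncomputable def quotCompShift (n : ℕ) (I : Ideal (MvPolynomial (Fin n) ℚ)) (d a : ℕ) :
    Submodule ℚ (MvPolynomial (Fin n) ℚ ⧸ I) :=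
  if a ≤ d then quotComp n I (d - a) else ⊥

lemma packedk_comp {n k : ℕ} {w : Fin n → ℕ} (σ : Equiv.Perm (Fin n)) (h : Packedk n k w) :
    Packedk n k (w ∘ σ) := by
  obtain ⟨h1, h2, h3⟩ := h
  refine ⟨fun p => h1 _, fun i hi hex => ?_, fun j hj hjk => ?_⟩
  · obtain ⟨q, hq⟩ := h2 i hi (by obtain ⟨p, hp⟩ := hex; exact ⟨σ p, hp⟩)
    exact ⟨σ.symm q, by simpa using hq⟩
  · obtain ⟨q, hq⟩ := h3 j hj hjk
    exact ⟨σ.symm q, by simpa using hq⟩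

/-- The left action of a permutation `σ ∈ S_n` on packed words, sending `w` to
`w ∘ σ⁻¹` (the permutation action on positions). -/
noncomputable def wordPerm (n k : ℕ) (σ : Equiv.Perm (Fin n)) :
    {w : Fin n → ℕ // Packedk n k w} ≃ {w : Fin n → ℕ // Packedk n k w} where
  toFun w := ⟨w.1 ∘ σ.symm, packedk_comp σ.symm w.2⟩
  invFun w := ⟨w.1 ∘ σ, packedk_comp σ w.2⟩
  left_inv w := Subtype.ext (funext fun p => by simp)
  right_inv w := Subtype.ext (funext fun p => by simp)

open PowerSeries in
/-- The generating function of the elementary symmetric functions. -/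
lemma coeff_prod_one_sub_C_mul_X {ι R : Type*} [CommRing R] (s : Finset ι) (x : ι → R) (a : ℕ) :
    coeff a (∏ i ∈ s, (1 - C (x i) * X)) =
      (-1) ^ a * ∑ t ∈ s.powersetCard a, ∏ j ∈ t, x j := by
  classical
  have h (t : Finset ι) : ∏ i ∈ t, -(C (x i) * X) =
      C ((-1) ^ t.card * ∏ i ∈ t, x i) * X ^ t.card := by
    simp [Finset.prod_neg, Finset.prod_mul_distrib, mul_assoc]
  simp_rw [sub_eq_add_neg, Finset.prod_one_add, h, map_sum, coeff_C_mul, coeff_X_pow]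
  rw [Finset.mul_sum, Finset.powersetCard_eq_filter, Finset.sum_filter]
  refine Finset.sum_congr rfl fun t _ => ?_
  by_cases hta : t.card = a
  · simp [hta]
  · simp [hta, Ne.symm hta]

/-- `hval` as a sum over multisets of indices, without the monadic coercion to `Multiset ℕ`. -/
lemma hval_eq_sum (b d : ℕ) (α : ℕ → ℚ) :
    hval b d α =
      ∑ m : Sym (Fin d) b, (Multiset.map (fun j : Fin d => α ((j : ℕ) + 1)) m.1).prod := by
  simp [hval]

lemma hval_zero (d : ℕ) (α : ℕ → ℚ) : hval 0 d α = 1 := by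
  rw [hval_eq_sum, Fintype.sum_unique]
  exact congrArg Multiset.prod (Multiset.map_zero _)

open PowerSeries in
/-- The generating function of the complete homogeneous symmetric functions. -/
lemma mk_hval (k : ℕ) (α : ℕ → ℚ) :
    mk (fun b => hval b k α) = ∏ j : Fin k, mk fun b => α ((j : ℕ) + 1) ^ b := by
  ext b
  rw [coeff_mk, coeff_prod, hval_eq_sum]
  refine Finset.sum_bij' (fun m _ => Multiset.toFinsupp (m : Multiset (Fin k)))
    (fun f hf => ⟨Finsupp.toMultiset f, ?_⟩) ?_ ?_ ?_ ?_ ?_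
  · rw [Finset.mem_finsuppAntidiag] at hf
    rw [Finsupp.card_toMultiset, ← hf.1, Finsupp.sum_fintype] <;> simp
  · intro m _
    rw [Finset.mem_finsuppAntidiag]
    refine ⟨?_, Finset.subset_univ _⟩
    exact (Multiset.sum_count_eq_card fun _ _ => Finset.mem_univ _).trans m.2
  · exact fun _ _ => Finset.mem_univ _
  · intro m _
    ext1
    simp
  · simp
  · intro m _
    rw [Finset.prod_multiset_map_count]
    refine (Finset.prod_subset (Finset.subset_univ _) fun j _ hj => ?_).trans ?_
    · rw [Multiset.mem_toFinset] at hj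
      rw [Multiset.count_eq_zero.mpr hj, pow_zero]
    · simp

open PowerSeries in
lemma mk_hval_mul_prod (k : ℕ) (α : ℕ → ℚ) :
    mk (fun b => hval b k α) * ∏ j : Fin k, (1 - C (α ((j : ℕ) + 1)) * X) = 1 := by
  rw [mk_hval, ← Finset.prod_mul_distrib]
  refine Finset.prod_eq_one fun j _ => ?_
  ext b
  rw [mul_sub, mul_one, mul_left_comm]
  cases b with
  | zero => simp
  | succ b => simp [coeff_succ_mul_X, coeff_one, pow_succ']

lemma eval_esymmOn (n : ℕ) (s : Finset (Fin n)) (a : ℕ) (x : Fin n → ℚ) :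
    MvPolynomial.eval x (esymmOn n s a) = ∑ t ∈ s.powersetCard a, ∏ j ∈ t, x j := by
  simp [esymmOn]

lemma esymmOn_isHomogeneous (n : ℕ) (s : Finset (Fin n)) (a : ℕ) :
    (esymmOn n s a).IsHomogeneous a := by
  refine MvPolynomial.IsHomogeneous.sum _ _ _ fun t ht => ?_
  have h := MvPolynomial.IsHomogeneous.prod t (fun j => (MvPolynomial.X j : MvPolynomial (Fin n) ℚ))
    (fun _ => 1) fun j _ => MvPolynomial.isHomogeneous_X _ j
  simpa [(Finset.mem_powersetCard.mp ht).2] using h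

lemma esymmOn_ne_zero {n : ℕ} {s : Finset (Fin n)} {a : ℕ} (h : a ≤ s.card) :
    esymmOn n s a ≠ 0 := by
  intro h0
  have h1 := eval_esymmOn n s a 1
  simp [h0] at h1
  exact (Nat.choose_pos h).ne (by exact_mod_cast h1)

open PowerSeries in
/-- At a point of `X_{n,k}`, the degree-`d` coefficient of `∏ (1 - x_p t) / ∏ (1 - α_j t)`
vanishes for `d > n - k`, the quotient being a polynomial of degree at most `n - k`. -/
lemma sum_esymm_mul_hval_eq_zero {n k d : ℕ} (hd : n - k < d) {α : ℕ → ℚ}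
    {x : Fin n → ℚ} (hx : x ∈ packedPoints n k α) :
    ∑ a ∈ Finset.range (d + 1), (-1) ^ a *
      (∑ t ∈ Finset.univ.powersetCard a, ∏ j ∈ t, x j) * hval (d - a) k α = 0 := by
  classical
  obtain ⟨w, hw, rfl⟩ := hx
  choose g hg using fun j : Fin k => hw.2.2 (j + 1) (by omega) (by omega)
  have hginj : Function.Injective g := fun i j h => by
    have := hg i
    rw [h, hg j] at this
    exact Fin.ext (by omega)
  set s : Finset (Fin n) := Finset.univ.map ⟨g, hginj⟩ with hs
  have hsc : sᶜ.card = n - k := by simp [hs, Finset.card_compl]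
  have hprod : (∏ p, (1 - C (α (w p)) * X) : ℚ⟦X⟧) * mk (fun b => hval b k α) =
      ∏ p ∈ sᶜ, (1 - C (α (w p)) * X) := by
    rw [← Finset.prod_compl_mul_prod s, mul_assoc, hs, Finset.prod_map]
    simp only [Function.Embedding.coeFn_mk, hg]
    rw [mul_comm (∏ j : Fin k, _), mk_hval_mul_prod, mul_one]
  have h := congrArg (coeff d) hprod
  rw [coeff_prod_one_sub_C_mul_X, Finset.powersetCard_eq_empty.mpr (hsc ▸ hd), coeff_mul,
    Finset.Nat.sum_antidiagonal_eq_sum_range_succ_mk] at h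
  simpa [coeff_prod_one_sub_C_mul_X] using h

/-- for distinct rationals `α_1, …, α_n`, `1 ≤ k ≤ n` and `d > n - k`, the
polynomial `Σ_{a+b=d} (-1)^a e_a h_b(α_1, …, α_k)` vanishes at every point of `X_{n,k}`;
consequently `e_d ∈ T(X_{n,k})`. -/
theorem esymm_generator_vanishes (n k : ℕ) (hk : 1 ≤ k) (hkn : k ≤ n) (α : ℕ → ℚ)
    (hα : Set.InjOn α (Set.Icc 1 n)) (d : ℕ) (hd : n - k < d) :
    (∀ x ∈ packedPoints n k α,
      MvPolynomial.eval x
        (∑ a ∈ Finset.range (d + 1),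
          (-1) ^ a * esymmOn n (Finset.univ : Finset (Fin n)) a *
            MvPolynomial.C (hval (d - a) k α)) = 0) ∧
    esymmOn n (Finset.univ : Finset (Fin n)) d ∈ gradedIdeal n (packedPoints n k α) := by
  have hvan : ∀ x ∈ packedPoints n k α,
      MvPolynomial.eval x
        (∑ a ∈ Finset.range (d + 1),
          (-1) ^ a * esymmOn n (Finset.univ : Finset (Fin n)) a *
            MvPolynomial.C (hval (d - a) k α)) = 0 := fun x hx => by
    simpa [eval_esymmOn] using sum_esymm_mul_hval_eq_zero hd hx
  refine ⟨hvan, ?_⟩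
  obtain hdn | hdn := lt_or_ge n d
  · have : esymmOn n (Finset.univ : Finset (Fin n)) d = 0 := by
      rw [esymmOn, Finset.powersetCard_eq_empty.mpr (by simpa using hdn), Finset.sum_empty]
    simp [this]
  set f : MvPolynomial (Fin n) ℚ := ∑ a ∈ Finset.range (d + 1),
    (-1) ^ a * esymmOn n (Finset.univ : Finset (Fin n)) a *
      MvPolynomial.C (hval (d - a) k α) with hf
  have hterm (a : ℕ) : ((-1) ^ a * esymmOn n (Finset.univ : Finset (Fin n)) a *
      MvPolynomial.C (hval (d - a) k α)).IsHomogeneous a := by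
    have h := ((esymmOn_isHomogeneous n Finset.univ a).C_mul ((-1) ^ a)).mul
      (MvPolynomial.isHomogeneous_C (Fin n) (hval (d - a) k α))
    simpa using h
  have hcomp : MvPolynomial.homogeneousComponent d f =
      (-1) ^ d * esymmOn n (Finset.univ : Finset (Fin n)) d := by
    rw [hf, map_sum, Finset.sum_eq_single_of_mem d (by simp)]
    · rw [MvPolynomial.homogeneousComponent_eq_self (hterm d)]
      simp [hval_zero]
    · intro a _ had
      rw [MvPolynomial.homogeneousComponent_of_mem (hterm a), if_neg had.symm]
  have hne : MvPolynomial.homogeneousComponent d f ≠ 0 := by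
    rw [hcomp]
    exact mul_ne_zero (by simp) (esymmOn_ne_zero (by simpa using hdn))
  have hdeg : f.totalDegree = d := by
    refine le_antisymm (MvPolynomial.totalDegree_finsetSum_le fun a ha => ?_) ?_
    · exact (hterm a).totalDegree_le.trans (by simpa [Nat.lt_succ_iff] using ha)
    · by_contra! hlt
      exact hne (MvPolynomial.homogeneousComponent_eq_zero _ _ hlt)
  have hmem : (-1) ^ d * esymmOn n (Finset.univ : Finset (Fin n)) d ∈
      gradedIdeal n (packedPoints n k α) :=
    Ideal.subset_span ⟨f, fun h0 => hne (by simp [h0]), hvan, by rw [hdeg, hcomp]⟩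
  have h := Ideal.mul_mem_left _ ((-1) ^ d) hmem
  rwa [← mul_assoc, ← mul_pow, neg_one_mul, neg_neg, one_pow, one_mul] at h

end PackedWords
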